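/- Let s_1, …, s_n ∈ V be source nodes and d ∈ V a destination node with d ≠ s_i for all i, and let R_1, …, R_n ≥ 0 be rates. Assume that for every S ⊆ V with d ∉ S, Σ_{i : s_i ∈ S} R_i ≤ f_H(S). Then there exists an acyclic edge set E' ⊆ V × V such that the E'-subnetwork H' of H satisfies: for every S ⊆ V with d ∉ S, Σ_{i : s_i ∈ S} R_i ≤ f_{H'}(S). -/

import Mathlib

open Matrix Complex

open scoped Classical

/-- The submatrix of the channel matrix `H` corresponding to a cut `S`:
rows are the receive antennas owned by nodes outside `S`, columns are the
transmit antennas owned by nodes inside `S`. -/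
noncomputable def cutMatrix {V T Rx : Type*} (τ : T → V) (ρ : Rx → V)
    (H : Matrix Rx T ℂ) (S : Set V) :
    Matrix {r : Rx // ρ r ∉ S} {t : T // τ t ∈ S} ℂ :=
  fun r t => H r.1 t.1

/-- The Gaussian cut value `f_H(S) = log re (det (1 + H_S * diagonal p * H_Sᴴ))`. -/
noncomputable def cutValue {V T Rx : Type*} [Fintype T] [Fintype Rx]
    (τ : T → V) (ρ : Rx → V) (H : Matrix Rx T ℂ) (p : T → ℝ) (S : Set V) : ℝ :=
  Real.log ((1 + cutMatrix τ ρ H S *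
      Matrix.diagonal (fun t : {t : T // τ t ∈ S} => (p t.1 : ℂ)) *
      (cutMatrix τ ρ H S)ᴴ).det.re)

/-- The minimum of `f` over all `s`–`d` cuts, i.e. over all `S ⊆ V` with `s ∈ S` and
`d ∉ S`.  For `V` finite and `s ≠ d` this collection is finite and nonempty, so the
infimum below is attained and is the minimum. -/
noncomputable def cutMin {V : Type*} (s d : V) (f : Set V → ℝ) : ℝ :=
  sInf (f '' {S : Set V | s ∈ S ∧ d ∉ S})

/-- An edge set `E ⊆ V × V` is acyclic if the transitive closure of the corresponding
relation is irreflexive (no directed cycles; in particular no self-loops and no pair of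
oppositely directed edges). -/
def AcyclicEdgeSet {V : Type*} (E : Set (V × V)) : Prop :=
  Irreflexive (Relation.TransGen fun u w => (u, w) ∈ E)

/-- The `E`-subnetwork of the channel matrix `H`: keep the entry `H r t` if the edge
`(τ t, ρ r)` is in `E`, and set it to zero otherwise. -/
noncomputable def subnetwork {V T Rx : Type*} (τ : T → V) (ρ : Rx → V)
    (H : Matrix Rx T ℂ) (E : Set (V × V)) : Matrix Rx T ℂ :=
  fun r t => if (τ t, ρ r) ∈ E then H r t else 0

/-- A submodular function of two sets that is nonnegative on the diagonal dominates
`(A, D) ↦ x(A) - x(D)` for some vector `x`. -/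
theorem exists_vector_le_of_submodular {V : Type*} [Fintype V]
    (φ : Finset V → Finset V → ℝ)
    (hsub : ∀ A D A' D', φ (A ∪ A') (D ∪ D') + φ (A ∩ A') (D ∩ D') ≤ φ A D + φ A' D')
    (hdiag : ∀ S, 0 ≤ φ S S) :
    ∃ x : V → ℝ, ∀ A D, ∑ v ∈ A, x v - ∑ v ∈ D, x v ≤ φ A D := by
  suffices h : ∀ W : Finset V, ∃ x : V → ℝ, ∀ A D, (∀ v ∉ W, v ∈ A ↔ v ∈ D) →
      ∑ v ∈ A, x v - ∑ v ∈ D, x v ≤ φ A D by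
    obtain ⟨x, hx⟩ := h Finset.univ
    exact ⟨x, fun A D => hx A D fun v hv => absurd (Finset.mem_univ v) hv⟩
  intro W
  induction W using Finset.induction_on with
  | empty =>
    refine ⟨0, fun A D h => ?_⟩
    obtain rfl : A = D := Finset.ext fun v => h v (Finset.notMem_empty v)
    simpa using hdiag A
  | insert v W hv ih =>
    obtain ⟨x, hx⟩ := ih
    let L : Finset (Finset V × Finset V) :=
      Finset.univ.filter fun q => (∀ u ∉ insert v W, u ∈ q.1 ↔ u ∈ q.2) ∧ v ∉ q.1 ∧ v ∈ q.2
    let low : Finset V × Finset V → ℝ := fun q => ∑ u ∈ q.1, x u - ∑ u ∈ q.2, x u - φ q.1 q.2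
    have hL : L.Nonempty := by
      refine ⟨(∅, {v}), ?_⟩
      simp only [L, Finset.mem_filter, Finset.mem_univ, true_and]
      refine ⟨fun u hu => ?_, by simp, by simp⟩
      simp only [Finset.mem_insert, not_or] at hu
      simp [hu.1]
    let δ := L.sup' hL low
    have hsum : ∀ A : Finset V, ∑ u ∈ A, (x u + if u = v then δ else 0) =
        ∑ u ∈ A, x u + if v ∈ A then δ else 0 := fun A => by
      rw [Finset.sum_add_distrib, Finset.sum_ite_eq']
    refine ⟨fun u => x u + if u = v then δ else 0, fun A D h => ?_⟩
    rw [hsum, hsum]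
    by_cases hA : v ∈ A <;> by_cases hD : v ∈ D
    · have := hx A D fun u hu => by
        by_cases huv : u = v
        · simp [huv, hA, hD]
        · exact h u (by simp [huv, hu])
      simp only [hA, hD, if_true]; linarith
    · have hδ : δ ≤ φ A D - (∑ u ∈ A, x u - ∑ u ∈ D, x u) := by
        refine Finset.sup'_le hL low fun q hq => ?_
        simp only [L, Finset.mem_filter, Finset.mem_univ, true_and] at hq
        obtain ⟨hq, hq1, hq2⟩ := hq
        have h1 := hx (A ∪ q.1) (D ∪ q.2) fun u hu => by
          by_cases huv : u = v
          · simp [huv, hA, hq2]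
          · simp [h u (by simp [huv, hu]), hq u (by simp [huv, hu])]
        have h2 := hx (A ∩ q.1) (D ∩ q.2) fun u hu => by
          by_cases huv : u = v
          · simp [huv, hD, hq1]
          · simp [h u (by simp [huv, hu]), hq u (by simp [huv, hu])]
        have h3 := hsub A D q.1 q.2
        have h4 := Finset.sum_union_inter (s₁ := A) (s₂ := q.1) (f := x)
        have h5 := Finset.sum_union_inter (s₁ := D) (s₂ := q.2) (f := x)
        simp only [low]
        linarith
      simp only [hA, hD, if_true, if_false]; linarith
    · have hδ : low (A, D) ≤ δ := by
        refine Finset.le_sup' low ?_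
        simp only [L, Finset.mem_filter, Finset.mem_univ, true_and]
        exact ⟨h, hA, hD⟩
      simp only [low] at hδ
      simp only [hA, hD, if_true, if_false]; linarith
    · have := hx A D fun u hu => by
        by_cases huv : u = v
        · simp [huv, hA, hD]
        · exact h u (by simp [huv, hu])
      simp only [hA, hD, if_false]; linarith

/-- A walk from `u` to `w` yields out- and in-degree vectors `o` and `i` such that, whenever no
edge leads from the complement of `A` to `D`, at most `o(A)` of its steps enter `D`. -/
theorem exists_degrees_of_transGen {V : Type*} (E : Set (V × V)) {u w : V}
    (h : Relation.TransGen (fun a b => (a, b) ∈ E) u w) :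
    ∃ o i : V → ℝ, (∀ v, o v - i v = (if v = u then 1 else 0) - if v = w then 1 else 0) ∧
      (∀ v, 0 ≤ o v) ∧ 0 < o u ∧
      ∀ A D : Finset V, (∀ a b, (a, b) ∈ E → b ∈ D → a ∈ A) →
        ∑ v ∈ D, i v ≤ ∑ v ∈ A, o v := by
  have step : ∀ a b : V, (a, b) ∈ E → ∀ A D : Finset V,
      (∀ a b, (a, b) ∈ E → b ∈ D → a ∈ A) →
      ∑ v ∈ D, (if v = b then (1 : ℝ) else 0) ≤ ∑ v ∈ A, if v = a then (1 : ℝ) else 0 := by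
    intro a b hab A D hAD
    rw [Finset.sum_ite_eq', Finset.sum_ite_eq']
    by_cases hb : b ∈ D
    · simp [hb, hAD a b hab hb]
    · simp only [hb, if_false]; split_ifs <;> norm_num
  induction h with
  | single hab =>
    exact ⟨_, _, fun v => rfl, fun v => by split_ifs <;> norm_num, by simp, step _ _ hab⟩
  | tail _ hab ih =>
    rename_i b c _
    obtain ⟨o, i, hoi, ho, hou, hAD⟩ := ih
    refine ⟨fun v => o v + if v = b then 1 else 0, fun v => i v + if v = c then 1 else 0,
      fun v => ?_, fun v => ?_, ?_, fun A D h => ?_⟩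
    · linarith [hoi v]
    · have := ho v
      dsimp only
      split_ifs <;> linarith
    · dsimp only
      split_ifs <;> linarith
    · rw [Finset.sum_add_distrib, Finset.sum_add_distrib]
      exact add_le_add (hAD A D h) (step _ _ hab A D h)

/-- Among the vectors `x` with `x(A) - x(D) ≤ φ(A, D)` for all `A`, `D`, there is one of minimal
total, provided that these constraints force `x` to be nonnegative. -/
theorem exists_vector_minimal_sum {V : Type*} [Fintype V] (φ : Finset V → Finset V → ℝ)
    (hpos : ∀ v, φ (Finset.univ.erase v) Finset.univ ≤ 0)
    (hne : ∃ x : V → ℝ, ∀ A D, ∑ v ∈ A, x v - ∑ v ∈ D, x v ≤ φ A D) :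
    ∃ x : V → ℝ, (∀ A D, ∑ v ∈ A, x v - ∑ v ∈ D, x v ≤ φ A D) ∧
      ∀ y : V → ℝ, (∀ A D, ∑ v ∈ A, y v - ∑ v ∈ D, y v ≤ φ A D) → ∑ v, x v ≤ ∑ v, y v := by
  obtain ⟨x₀, hx₀⟩ := hne
  have hnonneg : ∀ x : V → ℝ, (∀ A D, ∑ v ∈ A, x v - ∑ v ∈ D, x v ≤ φ A D) → ∀ v, 0 ≤ x v := by
    intro x hx v
    have h1 := (hx _ _).trans (hpos v)
    have h2 := Finset.add_sum_erase Finset.univ x (Finset.mem_univ v)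
    linarith
  let K : Set (V → ℝ) := {x | (∀ A D, ∑ v ∈ A, x v - ∑ v ∈ D, x v ≤ φ A D) ∧
    ∑ v, x v ≤ ∑ v, x₀ v}
  have hclosed : IsClosed K := by
    simp only [K, Set.ofPred_and, Set.ofPred_forall]
    refine IsClosed.inter (isClosed_iInter fun A => isClosed_iInter fun D => ?_) ?_
    · exact isClosed_le (by fun_prop) continuous_const
    · exact isClosed_le (by fun_prop) continuous_const
  have hcompact : IsCompact K := by
    refine (isCompact_Icc (a := (0 : V → ℝ)) (b := fun _ => ∑ v, x₀ v)).of_isClosed_subset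
      hclosed fun x hx => ⟨fun v => hnonneg x hx.1 v, fun v => ?_⟩
    exact (Finset.single_le_sum (fun u _ => hnonneg x hx.1 u) (Finset.mem_univ v)).trans hx.2
  obtain ⟨x, hxK, hmin⟩ := hcompact.exists_isMinOn ⟨x₀, hx₀, le_rfl⟩
    (f := fun x : V → ℝ => ∑ v, x v) (by fun_prop)
  refine ⟨x, hxK.1, fun y hy => ?_⟩
  rcases le_total (∑ v, y v) (∑ v, x₀ v) with h | h
  · exact hmin ⟨hy, h⟩
  · exact hxK.2.trans h

/-- A family `G E A D` of edge-set-dependent submodular functions, where `G E A D` only depends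
on the edges in `E` from `A` to the complement of `D`, admits an acyclic edge set whose diagonal
values dominate every modular function `b` of total zero dominated by the diagonal of
`G Set.univ`. -/
theorem exists_acyclic_dominating {V : Type*} [Fintype V]
    (G : Set (V × V) → Finset V → Finset V → ℝ)
    (hsub : ∀ E A D A' D',
      G E (A ∪ A') (D ∪ D') + G E (A ∩ A') (D ∩ D') ≤ G E A D + G E A' D')
    (hloc : ∀ E E' A D, (∀ a ∈ A, ∀ b ∉ D, (a, b) ∈ E ↔ (a, b) ∈ E') → G E A D = G E' A D)
    (huniv : ∀ E A, G E A Finset.univ = 0)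
    (b : V → ℝ) (hb : ∑ v, b v = 0) (hcut : ∀ S, ∑ v ∈ S, b v ≤ G Set.univ S S) :
    ∃ E, AcyclicEdgeSet E ∧ ∀ S, ∑ v ∈ S, b v ≤ G E S S := by
  let Feas : Set (V × V) → (V → ℝ) → Prop := fun E x =>
    ∀ A D : Finset V, ∑ v ∈ A, x v - ∑ v ∈ D, x v ≤ G E A D - ∑ v ∈ D, b v
  have hfull : ∃ x, Feas Set.univ x := by
    refine exists_vector_le_of_submodular (fun A D => G Set.univ A D - ∑ v ∈ D, b v)
      (fun A D A' D' => ?_) fun S => sub_nonneg.2 (hcut S)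
    have h1 := hsub Set.univ A D A' D'
    have h2 := Finset.sum_union_inter (s₁ := D) (s₂ := D') (f := b)
    linarith
  obtain ⟨E, hE, hEmin⟩ : ∃ E, (∃ x, Feas E x) ∧ ∀ E', (∃ x, Feas E' x) → E' ⊆ E → E ⊆ E' := by
    obtain ⟨E, hE⟩ := (Set.toFinite {E | ∃ x, Feas E x}).exists_minimal ⟨Set.univ, hfull⟩
    exact ⟨E, hE.1, fun E' h => hE.2 h⟩
  obtain ⟨x, hx, hxmin⟩ := exists_vector_minimal_sum (fun A D => G E A D - ∑ v ∈ D, b v)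
    (fun v => by simp [huniv, hb]) hE
  have htight : ∀ A D : Finset V,
      ∑ v ∈ A, x v - ∑ v ∈ D, x v = G E A D - ∑ v ∈ D, b v →
      ∀ a c, (a, c) ∈ E → c ∈ D → a ∈ A := by
    intro A D hAD a c hac hc
    by_contra ha
    let E' : Set (V × V) := {e ∈ E | e.2 ∈ D → e.1 ∈ A}
    have hE' : Feas E' x := by
      intro A₂ D₂
      have h1 := hsub E' A D A₂ D₂
      rw [hloc E' E (A ∪ A₂) (D ∪ D₂) fun a _ c hc => by
          simp only [Finset.mem_union, not_or] at hc; simp [E', hc.1],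
        hloc E' E (A ∩ A₂) (D ∩ D₂) fun a ha c _ => by
          simp only [Finset.mem_inter] at ha; simp [E', ha.1],
        hloc E' E A D fun a ha c _ => by simp [E', ha]] at h1
      have h2 := hx (A ∪ A₂) (D ∪ D₂)
      have h3 := hx (A ∩ A₂) (D ∩ D₂)
      have h4 := Finset.sum_union_inter (s₁ := A) (s₂ := A₂) (f := x)
      have h5 := Finset.sum_union_inter (s₁ := D) (s₂ := D₂) (f := x)
      have h6 := Finset.sum_union_inter (s₁ := D) (s₂ := D₂) (f := b)
      linarith
    exact ha ((hEmin E' ⟨x, hE'⟩ (fun e he => he.1) hac).2 hc)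
  refine ⟨E, fun u hu => ?_, fun S => by linarith [hx S S]⟩
  obtain ⟨o, i, hoi, ho, hou, hdeg⟩ := exists_degrees_of_transGen E hu
  obtain rfl : o = i := funext fun v => by linarith [hoi v]
  have hstep : ∃ ε > 0, ∀ q : Finset V × Finset V,
      ε * (∑ v ∈ q.2, o v - ∑ v ∈ q.1, o v) ≤
        G E q.1 q.2 - ∑ v ∈ q.2, b v - (∑ v ∈ q.1, x v - ∑ v ∈ q.2, x v) := by
    have hev : ∀ q : Finset V × Finset V, ∀ᶠ ε in nhdsWithin (0 : ℝ) (Set.Ioi 0),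
        ε * (∑ v ∈ q.2, o v - ∑ v ∈ q.1, o v) ≤
          G E q.1 q.2 - ∑ v ∈ q.2, b v - (∑ v ∈ q.1, x v - ∑ v ∈ q.2, x v) := by
      intro q
      rcases (hx q.1 q.2).eq_or_lt with h | h
      · filter_upwards [self_mem_nhdsWithin] with ε hε
        rw [← h, sub_self]
        exact mul_nonpos_of_nonneg_of_nonpos (le_of_lt hε)
          (sub_nonpos.2 (hdeg _ _ (htight _ _ h)))
      · have hc : Filter.Tendsto (fun ε : ℝ => ε * (∑ v ∈ q.2, o v - ∑ v ∈ q.1, o v))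
            (nhds 0) (nhds (0 * (∑ v ∈ q.2, o v - ∑ v ∈ q.1, o v))) :=
          (continuous_id.mul continuous_const).tendsto 0
        rw [zero_mul] at hc
        exact ((hc.mono_left nhdsWithin_le_nhds).eventually_lt_const (sub_pos.2 h)).mono
          fun ε hε => hε.le
    obtain ⟨ε, hε, hε0⟩ := ((Filter.eventually_all.2 hev).and self_mem_nhdsWithin).exists
    exact ⟨ε, hε0, hε⟩
  obtain ⟨ε, hε, hstep⟩ := hstep
  have hlt := hxmin (fun v => x v - ε * o v) fun A D => by
    have := hstep (A, D)
    simp only [Finset.sum_sub_distrib, ← Finset.mul_sum]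
    linarith
  simp only [Finset.sum_sub_distrib, ← Finset.mul_sum] at hlt
  have hpos : 0 < ∑ v, o v := Finset.sum_pos' (fun v _ => ho v) ⟨u, Finset.mem_univ u, hou⟩
  nlinarith [mul_pos hε hpos]

open scoped ComplexOrder in
theorem one_le_det_one_add_of_posSemidef {m : Type*} [Fintype m] [DecidableEq m] {Q : Matrix m m ℂ}
    (hQ : Q.PosSemidef) : 1 ≤ (1 + Q).det := by
  have h1 : (1 + Q).det = ∏ i, (1 + (hQ.1.eigenvalues i : ℂ)) := by
    have h := congrArg (Polynomial.eval (-1)) hQ.1.charpoly_eq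
    rw [Matrix.eval_charpoly, Polynomial.eval_prod] at h
    have h2 : Matrix.scalar m (-1 : ℂ) - Q = -(1 + Q) := by
      rw [map_neg, map_one]; abel
    rw [h2, Matrix.det_neg] at h
    have h3 : ∀ i, Polynomial.eval (-1 : ℂ)
        (Polynomial.X - Polynomial.C (hQ.1.eigenvalues i : ℂ)) =
        -1 * (1 + (hQ.1.eigenvalues i : ℂ)) := fun i => by
      simp only [Polynomial.eval_sub, Polynomial.eval_X, Polynomial.eval_C]; ring
    erw [Finset.prod_congr rfl fun i _ => h3 i] at h
    rw [Finset.prod_mul_distrib, Finset.prod_const, Finset.card_univ] at h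
    exact mul_left_cancel₀ (pow_ne_zero _ (by norm_num)) h
  rw [h1]
  have h4 : (1 : ℝ) ≤ ∏ i, (1 + hQ.1.eigenvalues i) :=
    Finset.prod_induction _ (fun x : ℝ => 1 ≤ x) (fun a b => one_le_mul_of_one_le_of_one_le)
      le_rfl fun i _ => le_add_of_nonneg_right (hQ.eigenvalues_nonneg i)
  exact_mod_cast h4

open scoped ComplexOrder MatrixOrder in
/-- The determinant is monotone on positive definite matrices. -/
theorem det_le_det_add_of_posDef {m : Type*} [Fintype m] [DecidableEq m] {S Q : Matrix m m ℂ}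
    (hS : S.PosDef) (hQ : Q.PosSemidef) : S.det ≤ (S + Q).det := by
  obtain ⟨C, hC⟩ := CStarAlgebra.nonneg_iff_eq_star_mul_self.mp hQ.nonneg
  rw [hC, Matrix.star_eq_conjTranspose,
    Matrix.det_add_mul _ _ (S.isUnit_iff_isUnit_det.mp hS.isUnit)]
  exact le_mul_of_one_le_right hS.det_pos.le
    (one_le_det_one_add_of_posSemidef (hS.inv.posSemidef.mul_mul_conjTranspose_same C))

open scoped ComplexOrder in
/-- The Schur complement of a positive definite block matrix is positive definite, and the
determinant factors through it. -/
theorem posDef_schur_complement {m n : Type*} [Fintype m] [Fintype n] [DecidableEq m]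
    [DecidableEq n]
    {A : Matrix m m ℂ} {B : Matrix m n ℂ} {D : Matrix n n ℂ}
    (h : (Matrix.fromBlocks A B Bᴴ D).PosDef) :
    A.PosDef ∧ (D - Bᴴ * A⁻¹ * B).PosDef ∧
      (Matrix.fromBlocks A B Bᴴ D).det = A.det * (D - Bᴴ * A⁻¹ * B).det := by
  have hA : A.PosDef := h.submatrix (e := Sum.inl) Sum.inl_injective
  let _ : Invertible A := hA.isUnit.invertible
  have hdet := Matrix.det_fromBlocks₁₁ A B Bᴴ D
  rw [Matrix.invOf_eq_nonsing_inv] at hdet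
  refine ⟨hA, ?_, hdet⟩
  rw [((Matrix.PosDef.fromBlocks₁₁ B D hA).1 h.posSemidef).posDef_iff_det_ne_zero]
  exact right_ne_zero_of_mul (hdet ▸ h.det_pos.ne')

open scoped ComplexOrder in
/-- **Fischer's inequality**. -/
theorem det_fromBlocks_le_of_posDef {m n : Type*} [Fintype m] [Fintype n] [DecidableEq m]
    [DecidableEq n]
    {A : Matrix m m ℂ} {B : Matrix m n ℂ} {D : Matrix n n ℂ}
    (h : (Matrix.fromBlocks A B Bᴴ D).PosDef) :
    (Matrix.fromBlocks A B Bᴴ D).det ≤ A.det * D.det := by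
  obtain ⟨hA, hS, hdet⟩ := posDef_schur_complement h
  rw [hdet]
  refine mul_le_mul_of_nonneg_left ?_ hA.det_pos.le
  simpa using det_le_det_add_of_posDef hS
    (hA.inv.posSemidef.conjTranspose_mul_mul_same B)

open scoped ComplexOrder in
/-- A conditional form of Fischer's inequality, for a positive definite matrix partitioned into
three blocks. -/
theorem det_mul_det_le_of_posDef_sum.{u} {l m n : Type u} [Fintype l] [Fintype m] [Fintype n]
    [DecidableEq l] [DecidableEq m] [DecidableEq n]
    {K : Matrix (l ⊕ m ⊕ n) (l ⊕ m ⊕ n) ℂ} (hK : K.PosDef) :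
    K.det * (K.submatrix Sum.inl Sum.inl).det ≤
      (K.submatrix (Sum.map id Sum.inl) (Sum.map id Sum.inl) : Matrix (l ⊕ m) (l ⊕ m) ℂ).det *
      (K.submatrix (Sum.map id Sum.inr) (Sum.map id Sum.inr) : Matrix (l ⊕ n) (l ⊕ n) ℂ).det := by
  let A : Matrix l l ℂ := K.submatrix Sum.inl Sum.inl
  let B : Matrix l (m ⊕ n) ℂ := K.submatrix Sum.inl Sum.inr
  let D : Matrix (m ⊕ n) (m ⊕ n) ℂ := K.submatrix Sum.inr Sum.inr
  have hentry : ∀ i j, star (K j i) = K i j := fun i j => hK.1.apply i j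
  have hblocks : ∀ {k : Type u} (f : k → m ⊕ n),
      K.submatrix (Sum.map id f) (Sum.map id f) =
        Matrix.fromBlocks A (B.submatrix id f) (B.submatrix id f)ᴴ (D.submatrix f f) := by
    intro k f
    ext i j
    rcases i with i | i <;> rcases j with j | j <;> simp [A, B, D, hentry]
  have hK0 : K = Matrix.fromBlocks A B Bᴴ D := by
    ext i j
    rcases i with i | i <;> rcases j with j | j <;> simp [A, B, D, hentry]
  have h0 := posDef_schur_complement (hK0 ▸ hK)
  have h1 := posDef_schur_complement (hblocks (Sum.inl : m → m ⊕ n) ▸ hK.submatrix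
    (Sum.map_injective.2 ⟨Function.injective_id, Sum.inl_injective⟩))
  have h2 := posDef_schur_complement (hblocks (Sum.inr : n → m ⊕ n) ▸ hK.submatrix
    (Sum.map_injective.2 ⟨Function.injective_id, Sum.inr_injective⟩))
  set S := D - Bᴴ * A⁻¹ * B with hSdef
  have hsub : ∀ {k : Type u} (f : k → m ⊕ n), D.submatrix f f -
      (B.submatrix id f)ᴴ * A⁻¹ * B.submatrix id f = S.submatrix f f := fun f => rfl
  have hS0 : S = Matrix.fromBlocks S.toBlocks₁₁ S.toBlocks₁₂ S.toBlocks₁₂ᴴ S.toBlocks₂₂ := by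
    ext i j
    rcases i with i | i <;> rcases j with j | j <;> simp [Matrix.toBlocks₁₁, Matrix.toBlocks₁₂,
      Matrix.toBlocks₂₂, ← h0.2.1.1.apply (Sum.inr _) (Sum.inl _)]
  have hF := det_fromBlocks_le_of_posDef (hS0 ▸ h0.2.1)
  rw [← hS0] at hF
  rw [hblocks, hblocks, h1.2.2, h2.2.2, hsub, hsub]
  rw [show K.det = A.det * S.det from hK0 ▸ h0.2.2]
  have hA := h0.1.det_pos.le
  calc A.det * S.det * A.det = A.det * A.det * S.det := by ring
    _ ≤ A.det * A.det * (S.toBlocks₁₁.det * S.toBlocks₂₂.det) :=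
      mul_le_mul_of_nonneg_left hF (mul_nonneg hA hA)
    _ = A.det * (S.submatrix Sum.inl Sum.inl).det *
        (A.det * (S.submatrix Sum.inr Sum.inr).det) := by
      change A.det * A.det * ((S.submatrix Sum.inl Sum.inl).det *
        (S.submatrix Sum.inr Sum.inr).det) = _
      ring

/-- The principal minor of `K` on the rows and columns in `Z`. -/
noncomputable def principalMinor {ι : Type*} [Fintype ι] [DecidableEq ι] (K : Matrix ι ι ℂ) 
    (Z : Set ι) : ℂ :=
  (K.submatrix (Subtype.val : Z → ι) Subtype.val).det

theorem det_submatrix_eq_principalMinor {ι κ : Type*} [Fintype ι] [Fintype κ]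
    [DecidableEq ι] [DecidableEq κ]
    (K : Matrix ι ι ℂ) {e : κ → ι} (he : Function.Injective e) {Z : Set ι}
    (hZ : ∀ i, i ∈ Z ↔ ∃ k, e k = i) :
    (K.submatrix e e).det = principalMinor K Z := by
  let f : κ ≃ Z := Equiv.ofBijective (fun k => ⟨e k, (hZ _).2 ⟨k, rfl⟩⟩)
    ⟨fun a b h => he (congrArg Subtype.val h), fun ⟨i, hi⟩ =>
      ((hZ i).1 hi).imp fun k hk => Subtype.ext hk⟩
  exact Matrix.det_submatrix_equiv_self f (K.submatrix Subtype.val Subtype.val)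

open scoped ComplexOrder in
/-- **Koteljanskii's inequality**. -/
theorem principalMinor_union_mul_inter_le {ι : Type*} [Fintype ι] [DecidableEq ι]
    {K : Matrix ι ι ℂ}
    (hK : K.PosDef) (Z W : Set ι) :
    principalMinor K (Z ∪ W) * principalMinor K (Z ∩ W) ≤
      principalMinor K Z * principalMinor K W := by
  let e : ↥(Z ∩ W) ⊕ ↥(Z \ W) ⊕ ↥(W \ Z) → ι :=
    Sum.elim Subtype.val (Sum.elim Subtype.val Subtype.val)
  have he : Function.Injective e := by
    rintro (⟨a, ha⟩ | ⟨a, ha⟩ | ⟨a, ha⟩) (⟨b, hb⟩ | ⟨b, hb⟩ | ⟨b, hb⟩) h <;>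
      simp only [e, Sum.elim_inl, Sum.elim_inr] at h <;> subst h <;>
      simp only [Set.mem_inter_iff, Set.mem_sdiff] at ha hb <;> first | rfl | tauto
  have h := det_mul_det_le_of_posDef_sum (hK.submatrix he)
  simp only [Matrix.submatrix_submatrix] at h
  rw [det_submatrix_eq_principalMinor K he (Z := Z ∪ W),
    det_submatrix_eq_principalMinor K (he.comp Sum.inl_injective) (Z := Z ∩ W),
    det_submatrix_eq_principalMinor K (he.comp
      (Sum.map_injective.2 ⟨Function.injective_id, Sum.inl_injective⟩)) (Z := Z),
    det_submatrix_eq_principalMinor K (he.comp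
      (Sum.map_injective.2 ⟨Function.injective_id, Sum.inr_injective⟩)) (Z := W)] at h
  · exact h
  all_goals
    intro i
    simp only [Sum.exists, Function.comp_apply, Sum.map_inl, Sum.map_inr, e, Sum.elim_inl,
      Sum.elim_inr, id_eq, Subtype.exists, exists_prop, exists_eq_right, Set.mem_inter_iff,
      Set.mem_union, Set.mem_sdiff] <;>
    tauto

/-- The Gaussian mutual information between the inputs at the nodes in `A` and the outputs at the
nodes outside `D`, the inputs outside `A` being known. The cut value is the case `A = D`. -/
noncomputable def pairCutValue {V T Rx : Type*} [Fintype T] [Fintype Rx]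
    (τ : T → V) (ρ : Rx → V) (H : Matrix Rx T ℂ) (p : T → ℝ) (A D : Set V) : ℝ :=
  Real.log ((1 + H.submatrix (Subtype.val : {r // ρ r ∉ D} → Rx)
        (Subtype.val : {t // τ t ∈ A} → T) *
      Matrix.diagonal (fun t : {t : T // τ t ∈ A} => (p t.1 : ℂ)) *
      (H.submatrix (Subtype.val : {r // ρ r ∉ D} → Rx)
        (Subtype.val : {t // τ t ∈ A} → T))ᴴ).det.re)

/-- The joint covariance matrix of the outputs and the normalized inputs. -/
noncomputable def jointCovariance {T Rx : Type*} [Fintype T]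
    (H : Matrix Rx T ℂ) (p : T → ℝ) : Matrix (Rx ⊕ T) (Rx ⊕ T) ℂ :=
  Matrix.fromBlocks
    (1 + (H * Matrix.diagonal fun t => (√(p t) : ℂ)) *
      (H * Matrix.diagonal fun t => (√(p t) : ℂ))ᴴ)
    (H * Matrix.diagonal fun t => (√(p t) : ℂ)) (H * Matrix.diagonal fun t => (√(p t) : ℂ))ᴴ 1

open scoped ComplexOrder in
theorem jointCovariance_posDef {T Rx : Type*} [Fintype T] [Fintype Rx]
    (H : Matrix Rx T ℂ) (p : T → ℝ) : (jointCovariance H p).PosDef := by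
  set G := H * Matrix.diagonal fun t => (√(p t) : ℂ) with hG
  have h : jointCovariance H p =
      Matrix.fromBlocks 1 G 0 1 * (Matrix.fromBlocks 1 G 0 1)ᴴ := by
    rw [Matrix.fromBlocks_conjTranspose, Matrix.fromBlocks_multiply]
    simp [jointCovariance, hG]
  rw [h]
  refine Matrix.PosDef.mul_conjTranspose_self _ (Matrix.vecMul_injective_of_isUnit ?_)
  rw [Matrix.isUnit_iff_isUnit_det, Matrix.det_fromBlocks_zero₂₁]
  simp

theorem pairCutValue_eq_log_principalMinor {V T Rx : Type*} [Fintype T] [Fintype Rx]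
    (τ : T → V) (ρ : Rx → V) (H : Matrix Rx T ℂ) (p : T → ℝ) (hp : ∀ t, 0 ≤ p t) (A D : Set V) :
    pairCutValue τ ρ H p A D = Real.log (principalMinor (jointCovariance H p)
      {i | Sum.elim (fun r => ρ r ∉ D) (fun t => τ t ∉ A) i}).re := by
  rw [← det_submatrix_eq_principalMinor (jointCovariance H p)
    (e := (Sum.map Subtype.val Subtype.val : {r // ρ r ∉ D} ⊕ {t // τ t ∉ A} → Rx ⊕ T))
    (Sum.map_injective.2 ⟨Subtype.val_injective, Subtype.val_injective⟩) (by
      rintro (r | t) <;> simp)]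
  set G := H * Matrix.diagonal fun t => (√(p t) : ℂ) with hG
  have h : (jointCovariance H p).submatrix
      (Sum.map Subtype.val Subtype.val : {r // ρ r ∉ D} ⊕ {t // τ t ∉ A} → Rx ⊕ T)
      (Sum.map Subtype.val Subtype.val : {r // ρ r ∉ D} ⊕ {t // τ t ∉ A} → Rx ⊕ T) =
      Matrix.fromBlocks ((1 + G * Gᴴ).submatrix Subtype.val Subtype.val)
        (G.submatrix Subtype.val Subtype.val) (Gᴴ.submatrix Subtype.val Subtype.val)
        (1 : Matrix {t // τ t ∉ A} {t // τ t ∉ A} ℂ) := by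
    ext i j
    rcases i with i | i <;> rcases j with j | j <;>
      simp [jointCovariance, hG, Matrix.one_apply, Subtype.ext_iff]
  rw [h, Matrix.det_fromBlocks_one₂₂, pairCutValue]
  congr 3
  ext r s
  have hGt : ∀ t, G r.1 t * star (G s.1 t) = H r.1 t * p t * star (H s.1 t) := fun t => by
    have : (p t : ℂ) = √(p t) * √(p t) := by exact_mod_cast (Real.mul_self_sqrt (hp t)).symm
    rw [hG, Matrix.mul_diagonal, Matrix.mul_diagonal, star_mul', this]
    simp only [Complex.star_def, Complex.conj_ofReal]
    ring
  have h1 := Fintype.sum_subtype_add_sum_subtype (fun t => τ t ∈ A) fun t => G r.1 t * star (G s.1 t)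
  simp only [Matrix.add_apply, Matrix.sub_apply, Matrix.submatrix_apply, Matrix.one_apply,
    Subtype.ext_iff]
  rw [Matrix.mul_apply, Matrix.mul_apply, Matrix.mul_apply]
  simp only [Matrix.conjTranspose_apply, Matrix.mul_diagonal, Matrix.submatrix_apply]
  rw [← h1]
  simp only [hGt]
  ring

open scoped ComplexOrder in
theorem pairCutValue_submodular {V T Rx : Type*} [Fintype T] [Fintype Rx]
    (τ : T → V) (ρ : Rx → V) (H : Matrix Rx T ℂ) (p : T → ℝ) (hp : ∀ t, 0 ≤ p t)
    (A D A' D' : Set V) :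
    pairCutValue τ ρ H p (A ∪ A') (D ∪ D') + pairCutValue τ ρ H p (A ∩ A') (D ∩ D') ≤
      pairCutValue τ ρ H p A D + pairCutValue τ ρ H p A' D' := by
  simp only [pairCutValue_eq_log_principalMinor τ ρ H p hp]
  set K := jointCovariance H p
  let Z : Set V → Set V → Set (Rx ⊕ T) := fun A D =>
    {i | Sum.elim (fun r => ρ r ∉ D) (fun t => τ t ∉ A) i}
  have hK : K.PosDef := jointCovariance_posDef H p
  have hpos : ∀ W, 0 < principalMinor K W := fun W =>
    (hK.submatrix Subtype.val_injective).det_pos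
  have hre : ∀ W, 0 < (principalMinor K W).re := fun W => (Complex.pos_iff.1 (hpos W)).1
  have hof : ∀ W, principalMinor K W = ((principalMinor K W).re : ℂ) := fun W =>
    Complex.ext rfl (Complex.pos_iff.1 (hpos W)).2.symm
  have h := principalMinor_union_mul_inter_le hK (Z A D) (Z A' D')
  have hinter : Z A D ∩ Z A' D' = Z (A ∪ A') (D ∪ D') := by
    ext (r | t) <;> simp [Z, not_or]
  have hunion : Z A D ∪ Z A' D' = Z (A ∩ A') (D ∩ D') := by
    ext (r | t) <;> simp [Z] <;> tauto
  rw [hinter, hunion, hof, hof (Z (A ∪ A') _), hof (Z A D), hof (Z A' D')] at h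
  rw [← Real.log_mul (hre _).ne' (hre _).ne', ← Real.log_mul (hre _).ne' (hre _).ne']
  refine Real.log_le_log (mul_pos (hre _) (hre _)) ?_
  rw [mul_comm]
  exact_mod_cast h

open scoped ComplexOrder in
theorem pairCutValue_nonneg {V T Rx : Type*} [Fintype T] [Fintype Rx]
    (τ : T → V) (ρ : Rx → V) (H : Matrix Rx T ℂ) (p : T → ℝ) (hp : ∀ t, 0 ≤ p t)
    (A D : Set V) : 0 ≤ pairCutValue τ ρ H p A D := by
  refine Real.log_nonneg ?_
  have hdiag : (Matrix.diagonal fun t : {t : T // τ t ∈ A} => (p t.1 : ℂ)).PosSemidef :=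
    Matrix.PosSemidef.diagonal fun t => by simpa using hp t.1
  exact (Complex.le_def.1 (one_le_det_one_add_of_posSemidef
    (hdiag.mul_mul_conjTranspose_same _))).1

theorem pairCutValue_univ {V T Rx : Type*} [Fintype T] [Fintype Rx]
    (τ : T → V) (ρ : Rx → V) (H : Matrix Rx T ℂ) (p : T → ℝ) (A : Set V) :
    pairCutValue τ ρ H p A Set.univ = 0 := by
  have : IsEmpty {r : Rx // ρ r ∉ (Set.univ : Set V)} := ⟨fun r => r.2 (Set.mem_univ _)⟩
  simp [pairCutValue]

theorem pairCutValue_subnetwork_congr {V T Rx : Type*} [Fintype T] [Fintype Rx]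
    (τ : T → V) (ρ : Rx → V) (H : Matrix Rx T ℂ) (p : T → ℝ) {E E' : Set (V × V)} {A D : Set V}
    (h : ∀ a ∈ A, ∀ b ∉ D, (a, b) ∈ E ↔ (a, b) ∈ E') :
    pairCutValue τ ρ (subnetwork τ ρ H E) p A D =
      pairCutValue τ ρ (subnetwork τ ρ H E') p A D := by
  have : (subnetwork τ ρ H E).submatrix (Subtype.val : {r // ρ r ∉ D} → Rx)
      (Subtype.val : {t // τ t ∈ A} → T) = (subnetwork τ ρ H E').submatrix Subtype.val
      Subtype.val := by
    ext r t
    simp [subnetwork, h _ t.2 _ r.2]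
  rw [pairCutValue, pairCutValue, this]

/-- (Multiple access.)  If the rate tuple `(R 1, …, R n)` lies in
the i.i.d.-evaluated cutset region of the Gaussian multiple-access network with channel
matrix `H`, sources `sc 1, …, sc n` and destination `d`, then it lies in the
corresponding region of some acyclic subnetwork of `H`. -/
theorem exists_acyclic_gaussian_subnetwork_multiple_access
    {V T Rx : Type*} [Fintype V] [Fintype T] [Fintype Rx]
    (τ : T → V) (ρ : Rx → V) (H : Matrix Rx T ℂ) (p : T → ℝ) (hp : ∀ t, 0 ≤ p t)
    (n : ℕ) (sc : Fin n → V) (d : V) (hd : ∀ i, d ≠ sc i)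
    (R : Fin n → ℝ) (hR : ∀ i, 0 ≤ R i)
    (hrate : ∀ S : Set V, d ∉ S →
      ∑ i ∈ Finset.univ.filter (fun i => sc i ∈ S), R i ≤ cutValue τ ρ H p S) :
    ∃ E' : Set (V × V), AcyclicEdgeSet E' ∧
      ∀ S : Set V, d ∉ S →
        ∑ i ∈ Finset.univ.filter (fun i => sc i ∈ S), R i ≤
          cutValue τ ρ (subnetwork τ ρ H E') p S := by
  have hcut : ∀ (H' : Matrix Rx T ℂ) (S : Set V),
      pairCutValue τ ρ H' p S S = cutValue τ ρ H' p S := fun H' S => rfl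
  have hfull : subnetwork τ ρ H Set.univ = H := by
    ext r t
    simp [subnetwork]
  let b : V → ℝ := fun v =>
    (∑ i, if sc i = v then R i else 0) - if v = d then ∑ i, R i else 0
  have hbsum : ∀ S : Finset V, ∑ v ∈ S, b v =
      ∑ i, (if sc i ∈ S then R i else 0) - if d ∈ S then ∑ i, R i else 0 := by
    intro S
    rw [Finset.sum_sub_distrib, Finset.sum_ite_eq', Finset.sum_comm]
    simp only [Finset.sum_ite_eq]
  obtain ⟨E, hE, hES⟩ := exists_acyclic_dominating
    (fun E A D => pairCutValue τ ρ (subnetwork τ ρ H E) p ↑A ↑D)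
    (fun E A D A' D' => by
      push_cast
      exact pairCutValue_submodular τ ρ _ p hp _ _ _ _)
    (fun E E' A D h => pairCutValue_subnetwork_congr τ ρ H p (by simpa using h))
    (fun E A => by rw [Finset.coe_univ, pairCutValue_univ])
    b (by rw [hbsum]; simp) (fun S => by
      rw [hbsum, hfull]
      by_cases hdS : d ∈ S
      · refine le_trans ?_ (pairCutValue_nonneg τ ρ H p hp _ _)
        rw [if_pos hdS, sub_nonpos]
        exact Finset.sum_le_sum fun i _ => by
          split_ifs
          exacts [le_rfl, hR i]
      · rw [if_neg hdS, sub_zero, hcut, ← Finset.sum_filter]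
        simpa using hrate S (by simpa using hdS))
  refine ⟨E, hE, fun S hdS => ?_⟩
  have h := hES S.toFinset
  rw [hbsum, if_neg (by simpa using hdS), sub_zero, ← Finset.sum_filter, Set.coe_toFinset,
    hcut] at h
  simpa using h
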